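/- Let a and b be natural numbers. If there exists a quasi-isometry f : ℤ^a → ℤ^b, where ℤ^a and ℤ^b carry the sup metrics d(r,s) = max_i |r_i − s_i|, then a = b. -/

import Mathlib

/-- A map `f : X → Y` between metric spaces is a quasi-isometric embedding if there are
constants `l ≥ 1` and `C ≥ 0` such that
`l⁻¹ * dist x x' - C ≤ dist (f x) (f x') ≤ l * dist x x' + C` for all `x x'`. -/
def IsQIEmbedding {X Y : Type*} [MetricSpace X] [MetricSpace Y] (f : X → Y) : Prop :=
  ∃ l C : ℝ, 1 ≤ l ∧ 0 ≤ C ∧ ∀ x x' : X,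
    l⁻¹ * dist x x' - C ≤ dist (f x) (f x') ∧ dist (f x) (f x') ≤ l * dist x x' + C

/-- A quasi-isometry is a quasi-isometric embedding whose image is coarsely dense:
there is `D ≥ 0` with every point of `Y` within distance `D` of the image of `f`. -/
def IsQuasiIsometry {X Y : Type*} [MetricSpace X] [MetricSpace Y] (f : X → Y) : Prop :=
  IsQIEmbedding f ∧ ∃ D : ℝ, 0 ≤ D ∧ ∀ y : Y, ∃ x : X, dist y (f x) ≤ D

/-- If `N ^ a` is bounded by a constant multiple of `N ^ b` for all `N ≥ 1`, then `a ≤ b`. -/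
theorem le_of_forall_pow_le_mul_pow {a b K : ℕ} (h : ∀ N : ℕ, 1 ≤ N → N ^ a ≤ K * N ^ b) :
    a ≤ b := by
  by_contra! hab
  have hN := h (K + 1) (by omega)
  have hpow : (K + 1) ^ (b + 1) ≤ (K + 1) ^ a := Nat.pow_le_pow_right (by omega) hab
  have hpos : 0 < (K + 1) ^ b := by positivity
  rw [pow_succ] at hpow
  nlinarith

/-- An injective, coarsely Lipschitz map `ℤ^a → ℤ^b` forces `a ≤ b`, by comparing growth. -/
theorem le_of_injective_of_dist_le {a b : ℕ} {h : (Fin a → ℤ) → (Fin b → ℤ)}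
    (hinj : Function.Injective h) {L C : ℝ} (hL : 0 ≤ L) (hC : 0 ≤ C)
    (hdist : ∀ x x', dist (h x) (h x') ≤ L * dist x x' + C) : a ≤ b := by
  obtain ⟨K, hK⟩ := exists_nat_ge (L + C)
  refine le_of_forall_pow_le_mul_pow (K := (2 * K + 1) ^ b) fun N hN => ?_
  have hN' : (1 : ℝ) ≤ N := by exact_mod_cast hN
  have hcard : (Finset.Icc (0 : Fin a → ℤ) (fun _ => (N : ℤ) - 1)).card ≤
      (Finset.Icc (fun i => h 0 i - (K * N : ℕ)) (fun i => h 0 i + (K * N : ℕ))).card := by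
    refine Finset.card_le_card_of_injOn h (fun x hx => ?_) hinj.injOn
    rw [Finset.mem_coe, Finset.mem_Icc] at hx
    have hx0 : dist x 0 ≤ N := by
      refine (dist_pi_le_iff (by positivity)).2 fun i => ?_
      have h0 : 0 ≤ x i := hx.1 i
      have h1 : x i ≤ N - 1 := hx.2 i
      rw [Int.dist_eq, Pi.zero_apply, Int.cast_zero, sub_zero, abs_of_nonneg (by exact_mod_cast h0)]
      exact_mod_cast (by omega : x i ≤ N)
    have hle : dist (h x) (h 0) ≤ K * N := by
      have := hdist x 0
      nlinarith [mul_le_mul_of_nonneg_left hx0 hL]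
    have hcoord (i : Fin b) : |h x i - h 0 i| ≤ (K * N : ℕ) := by
      have := (dist_le_pi_dist (h x) (h 0) i).trans hle
      rw [Int.dist_eq] at this
      exact_mod_cast this
    rw [Finset.mem_coe, Finset.mem_Icc]
    exact ⟨fun i => by have := abs_le.1 (hcoord i); dsimp only; linarith,
      fun i => by have := abs_le.1 (hcoord i); dsimp only; linarith⟩
  have hwidth (i : Fin b) :
      (h 0 i + (K * N : ℕ) + 1 - (h 0 i - (K * N : ℕ))).toNat = 2 * (K * N) + 1 := by
    omega
  simp only [Pi.card_Icc, Int.card_Icc, hwidth, Finset.prod_const, Finset.card_univ,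
    Fintype.card_fin, Pi.zero_apply, sub_add_cancel, sub_zero, Int.toNat_natCast] at hcard
  calc N ^ a ≤ (2 * (K * N) + 1) ^ b := hcard
    _ ≤ ((2 * K + 1) * N) ^ b := Nat.pow_le_pow_left (by nlinarith) b
    _ = (2 * K + 1) ^ b * N ^ b := mul_pow _ _ _

/-- A quasi-isometric embedding `ℤ^a → ℤ^b` forces `a ≤ b`. -/
theorem IsQIEmbedding.le {a b : ℕ} {f : (Fin a → ℤ) → (Fin b → ℤ)} (hf : IsQIEmbedding f) :
    a ≤ b := by
  obtain ⟨l, C, hl, hC, hf⟩ := hf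
  have hl0 : 0 < l := by linarith
  obtain ⟨m, hm⟩ := exists_nat_gt (l * C)
  have hm0 : (0 : ℝ) ≤ m := m.cast_nonneg
  have hscale (x x' : Fin a → ℤ) : dist ((m : ℤ) • x) ((m : ℤ) • x') = m * dist x x' := by
    simp only [dist_eq_norm, ← smul_sub, norm_smul]
    simp
  refine le_of_injective_of_dist_le (h := fun x => f ((m : ℤ) • x)) (L := l * m) (C := C)
    (fun x x' hxx' => ?_) (by positivity) hC fun x x' => ?_
  · by_contra hne
    obtain ⟨i, hi⟩ := Function.ne_iff.1 hne
    have hone : 1 ≤ dist x x' := by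
      refine le_trans ?_ (dist_le_pi_dist x x' i)
      rw [Int.dist_eq]
      exact_mod_cast Int.one_le_abs (sub_ne_zero.2 hi)
    have hlow := (hf ((m : ℤ) • x) ((m : ℤ) • x')).1
    rw [dist_eq_zero.2 hxx', hscale, sub_nonpos, inv_mul_le_iff₀ hl0] at hlow
    nlinarith
  · have := (hf ((m : ℤ) • x) ((m : ℤ) • x')).2
    rwa [hscale, ← mul_assoc] at this

/-- A quasi-isometry has a coarse inverse which is a quasi-isometric embedding. -/
theorem IsQuasiIsometry.exists_isQIEmbedding {X Y : Type*} [MetricSpace X] [MetricSpace Y]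
    {f : X → Y} (hf : IsQuasiIsometry f) : ∃ g : Y → X, IsQIEmbedding g := by
  obtain ⟨⟨l, C, hl, hC, hf⟩, D, hD, hdense⟩ := hf
  have hl0 : 0 < l := by linarith
  choose g hg using hdense
  refine ⟨g, l, l * (2 * D + C), hl, by positivity, fun y y' => ?_⟩
  have hy := hg y
  have hy' := hg y'
  obtain ⟨hlow, hup⟩ := hf (g y) (g y')
  constructor
  · have htri : dist y y' ≤ dist y (f (g y)) + dist (f (g y)) (f (g y')) + dist y' (f (g y')) := by
      simpa only [dist_comm y'] using dist_triangle4 y (f (g y)) (f (g y')) y'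
    rw [sub_le_iff_le_add, inv_mul_le_iff₀ hl0]
    have hll : 2 * D + C ≤ l * (l * (2 * D + C)) := by
      rw [← mul_assoc]
      exact le_mul_of_one_le_left (by positivity) (by nlinarith)
    linarith
  · have htri : dist (f (g y)) (f (g y')) ≤ dist y (f (g y)) + dist y y' + dist y' (f (g y')) := by
      simpa only [dist_comm y] using dist_triangle4 (f (g y)) y y' (f (g y'))
    have hbound : l⁻¹ * dist (g y) (g y') ≤ dist y y' + (2 * D + C) := by linarith
    rwa [inv_mul_le_iff₀ hl0, mul_add] at hbound

/-- If there is a quasi-isometry `ℤ^a → ℤ^b` (sup metrics), then `a = b`. -/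
theorem stmt4 (a b : ℕ) (f : (Fin a → ℤ) → (Fin b → ℤ)) (hf : IsQuasiIsometry f) :
    a = b := by
  obtain ⟨g, hg⟩ := hf.exists_isQIEmbedding
  exact le_antisymm hf.1.le hg.le
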